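/- arXiv:2103.03658 — 2 statements merged into one kernel-verified Lean document; each statement's English description precedes it below -/
import Mathlib

section
/- Let α ∈ (0,1), ε ∈ (0, 1−α), a < b, L = b − a. For an integer N ≥ 2 set h = L/N, x_i = a + i·h, ξ_k = k·h, σ₀ = 2 − α, and define the constant-basis weights ω₀ = (h/2)^{σ₀}/σ₀, ω_k = (ξ_{k+1/2}^{σ₀} − ξ_{k−1/2}^{σ₀})/σ₀ for 1 ≤ k ≤ N−1, and ω_N = (ξ_N^{σ₀} − ξ_{N−1/2}^{σ₀})/σ₀, where ξ_{k±1/2} = (k ± 1/2)h. For u : ℝ → ℝ let Φ(x,ξ) = δ²u(x,ξ)/ξ² and define the quadrature Q_i = Σ_{k=1}^N ω_k Φ(x_i, ξ_k) + ω₀ Φ(x_i, ξ₁). Suppose u is bounded and satisfies |u(s) − u(t)| ≤ M|s − t|^{α+ε} for all s, t ∈ ℝ and some M ≥ 0. Then there exists a constant C > 0, independent of N, such that for every N ≥ 2, max_{1 ≤ i ≤ N−1} | Q_i − ∫_0^L Φ(x_i, ξ) ξ^{1−α} dξ | ≤ C h^{ε}. -/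
open MeasureTheory Set

/-- Pointwise comparison of `D(ξ)/ξ²` and `D(t)/t²`. -/
lemma point_aux (β M h t x : ℝ) (D : ℝ → ℝ) (hβ : 0 < β) (hβ1 : β < 1) (hM : 0 ≤ M)
    (hh : 0 < h) (ht : h / 2 ≤ t) (hx : h ≤ x) (htx : |x - t| ≤ h / 2)
    (hD0 : ∀ t, 0 < t → |D t| ≤ 2 * M * t ^ β)
    (hD : ∀ s t, |D s - D t| ≤ 2 * M * |s - t| ^ β) :
    |D x / x ^ 2 - D t / t ^ 2| ≤ 6 * M * h ^ β / t ^ 2 := by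
  have htp : 0 < t := by linarith
  have hxp : 0 < x := by linarith
  have e : D x / x ^ 2 - D t / t ^ 2 =
      ((D x - D t) + D x * ((t - x) * (t + x)) / x ^ 2) / t ^ 2 := by
    field_simp; ring
  rw [e, abs_div, abs_of_pos (by positivity : 0 < t ^ 2)]
  gcongr
  have h1 : |D x - D t| ≤ 2 * M * h ^ β := by
    refine (hD x t).trans ?_
    gcongr
    linarith
  have h2 : |D x * ((t - x) * (t + x)) / x ^ 2| ≤ 4 * M * h ^ β := by
    have hb := abs_le.1 htx
    have hprod : |(t - x) * (t + x)| ≤ 2 * h * x := by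
      rw [abs_mul, abs_sub_comm t x, abs_of_pos (by linarith : 0 < t + x)]
      have : t + x ≤ 4 * x := by linarith
      calc |x - t| * (t + x) ≤ (h / 2) * (4 * x) := by gcongr
        _ = _ := by ring
    have hx1 : x ^ (β - 1) ≤ h ^ (β - 1) :=
      Real.rpow_le_rpow_of_nonpos hh hx (by linarith)
    rw [abs_div, abs_mul, abs_of_pos (by positivity : 0 < x ^ 2)]
    calc |D x| * |(t - x) * (t + x)| / x ^ 2
        ≤ (2 * M * x ^ β) * (2 * h * x) / x ^ 2 := by
          gcongr
          exact hD0 x hxp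
      _ = 4 * M * h * x ^ (β - 1) := by
          rw [Real.rpow_sub_one hxp.ne']; field_simp; ring
      _ ≤ 4 * M * h * h ^ (β - 1) := by gcongr
      _ = 4 * M * h ^ β := by
          rw [Real.rpow_sub_one hh.ne']; field_simp
  calc _ ≤ _ := abs_add_le _ _
    _ ≤ 2 * M * h ^ β + 4 * M * h ^ β := add_le_add h1 h2
    _ = _ := by ring

lemma cont_aux (α : ℝ) (D : ℝ → ℝ) (hDc : Continuous D) (p q : ℝ) (hp : 0 < p) (hpq : p ≤ q) :
    IntervalIntegrable (fun t => D t / t ^ 2 * t ^ (1 - α)) volume p q := by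
  apply ContinuousOn.intervalIntegrable
  rw [uIcc_of_le hpq]
  intro t ht
  have htp : 0 < t := lt_of_lt_of_le hp ht.1
  apply ContinuousAt.continuousWithinAt
  have := Real.continuousAt_rpow_const t (1 - α) (Or.inl htp.ne')
  exact (hDc.continuousAt.div (by fun_prop) (by positivity)).mul this

/-- Error on a single cell. -/
lemma cell_aux (α β M h p q x : ℝ) (D : ℝ → ℝ) (hα : 0 < α) (hα1 : α < 1)
    (hβ : 0 < β) (hβ1 : β < 1) (hM : 0 ≤ M)
    (hh : 0 < h) (hp : h / 2 ≤ p) (hpq : p ≤ q) (hx : h ≤ x)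
    (hxp : x - h / 2 ≤ p) (hxq : q ≤ x + h / 2) (hDc : Continuous D)
    (hD0 : ∀ t, 0 < t → |D t| ≤ 2 * M * t ^ β)
    (hD : ∀ s t, |D s - D t| ≤ 2 * M * |s - t| ^ β) :
    |(q ^ (2 - α) - p ^ (2 - α)) / (2 - α) * (D x / x ^ 2) -
      ∫ t in p..q, D t / t ^ 2 * t ^ (1 - α)| ≤
      6 * M * h ^ β * ((p ^ (-α) - q ^ (-α)) / α) := by
  have hpp : 0 < p := by linarith
  have h0 : (0:ℝ) ∉ uIcc p q := by
    rw [uIcc_of_le hpq]; intro h; linarith [h.1]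
  have i1 : ∫ t in p..q, t ^ (1 - α) = (q ^ (2 - α) - p ^ (2 - α)) / (2 - α) := by
    rw [integral_rpow (Or.inl (by linarith))]
    ring_nf
  have i2 : ∫ t in p..q, t ^ (-1 - α) = (p ^ (-α) - q ^ (-α)) / α := by
    rw [integral_rpow (Or.inr ⟨by linarith, h0⟩)]
    rw [show -1 - α + 1 = -α by ring]
    field_simp; ring
  rw [← i1, ← i2, ← intervalIntegral.integral_mul_const,
    ← intervalIntegral.integral_const_mul, ← intervalIntegral.integral_sub
      ((intervalIntegral.intervalIntegrable_rpow (Or.inr h0)).mul_const _)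
      (cont_aux α D hDc p q hpp hpq), ← Real.norm_eq_abs]
  apply intervalIntegral.norm_integral_le_of_norm_le hpq
  · refine Filter.Eventually.of_forall fun t ht => ?_
    have htp : 0 < t := by linarith [ht.1]
    have := point_aux β M h t x D hβ hβ1 hM hh (by linarith [ht.1]) hx
      (abs_le.2 ⟨by linarith [ht.1, ht.2], by linarith [ht.1, ht.2]⟩) hD0 hD
    rw [Real.norm_eq_abs, show t ^ (1 - α) * (D x / x ^ 2) - D t / t ^ 2 * t ^ (1 - α) =
      (D x / x ^ 2 - D t / t ^ 2) * t ^ (1 - α) by ring, abs_mul,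
      abs_of_nonneg (by positivity : 0 ≤ t ^ (1 - α))]
    calc _ ≤ 6 * M * h ^ β / t ^ 2 * t ^ (1 - α) := by gcongr
      _ = _ := by
        rw [show -1 - α = (1 - α) - (2:ℕ) by push_cast; ring, Real.rpow_sub_natCast htp.ne']
        field_simp
  · exact (intervalIntegral.intervalIntegrable_rpow (Or.inr h0)).const_mul _

/-- Near-origin part. -/
lemma zero_aux (α ε M q : ℝ) (D : ℝ → ℝ) (hε : 0 < ε) (hM : 0 ≤ M) (hq : 0 < q)
    (hDc : Continuous D) (hD0 : ∀ t, 0 < t → |D t| ≤ 2 * M * t ^ (α + ε)) :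
    IntervalIntegrable (fun t => D t / t ^ 2 * t ^ (1 - α)) volume 0 q ∧
    |∫ t in (0:ℝ)..q, D t / t ^ 2 * t ^ (1 - α)| ≤ 2 * M * (q ^ ε / ε) := by
  have hb : ∀ t ∈ Ioc 0 q, ‖D t / t ^ 2 * t ^ (1 - α)‖ ≤ 2 * M * t ^ (ε - 1) := by
    intro t ht
    have htp : 0 < t := ht.1
    rw [Real.norm_eq_abs, abs_mul, abs_div, abs_of_pos (by positivity : 0 < t ^ 2),
      abs_of_pos (by positivity : 0 < t ^ (1 - α))]
    calc _ ≤ 2 * M * t ^ (α + ε) / t ^ 2 * t ^ (1 - α) := by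
          gcongr
          exact hD0 t htp
      _ = _ := by
        have e : t ^ (ε - 1) = t ^ (α + ε) * t ^ (1 - α) / t ^ 2 := by
          rw [← Real.rpow_add htp, ← Real.rpow_sub_natCast htp.ne']
          congr 1; push_cast; ring
        rw [e]; ring
  have hi : IntervalIntegrable (fun t : ℝ => 2 * M * t ^ (ε - 1)) volume 0 q :=
    (intervalIntegral.intervalIntegrable_rpow' (by linarith)).const_mul _
  have hI : ∫ t in (0:ℝ)..q, 2 * M * t ^ (ε - 1) = 2 * M * (q ^ ε / ε) := by
    rw [intervalIntegral.integral_const_mul, integral_rpow (Or.inl (by linarith))]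
    rw [show ε - 1 + 1 = ε by ring, Real.zero_rpow hε.ne', sub_zero]
  refine ⟨?_, ?_⟩
  · refine hi.mono_fun' ?_ ?_
    · have := hDc.measurable
      exact Measurable.aestronglyMeasurable (by fun_prop)
    · rw [uIoc_of_le hq.le]
      exact (ae_restrict_iff' measurableSet_Ioc).2 (Filter.Eventually.of_forall hb)
  · rw [← hI, ← Real.norm_eq_abs]
    exact intervalIntegral.norm_integral_le_of_norm_le hq.le
      (Filter.Eventually.of_forall hb) hi

/-- Cell boundaries. -/
noncomputable def cellPt (N : ℕ) (h : ℝ) (k : ℕ) : ℝ :=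
  if k = N then (N : ℝ) * h else ((k : ℝ) + 1/2) * h

lemma main_aux (α ε M h : ℝ) (N : ℕ) (D : ℝ → ℝ) (hα : 0 < α) (hα1 : α < 1) (hε : 0 < ε)
    (hε1 : ε < 1 - α) (hM : 0 ≤ M) (hh : 0 < h) (hN : 2 ≤ N) (hDc : Continuous D)
    (hD0 : ∀ t, 0 < t → |D t| ≤ 2 * M * t ^ (α + ε))
    (hD : ∀ s t, |D s - D t| ≤ 2 * M * |s - t| ^ (α + ε)) (ω : ℕ → ℝ)
    (hω0 : ω 0 = (h / 2) ^ (2 - α) / (2 - α))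
    (hω : ∀ k < N, ω (k + 1) =
      (cellPt N h (k + 1) ^ (2 - α) - cellPt N h k ^ (2 - α)) / (2 - α)) :
    |((∑ k ∈ Finset.range N, ω (k + 1) * (D ((k + 1 : ℕ) * h) / ((k + 1 : ℕ) * h) ^ 2)) +
      ω 0 * (D h / h ^ 2)) - ∫ t in (0:ℝ)..(N * h), D t / t ^ 2 * t ^ (1 - α)| ≤
      (2 * M + 2 * M / ε + 12 * M / α) * h ^ ε := by
  set p := cellPt N h with hp
  set F : ℝ → ℝ := fun t => D t / t ^ 2 * t ^ (1 - α) with hF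
  have hp0 : p 0 = h / 2 := by
    simp only [hp, cellPt]; rw [if_neg (by omega)]; push_cast; ring
  have hpN : p N = N * h := by simp [hp, cellPt]
  have hcell : ∀ k < N, h / 2 ≤ p k ∧ p k ≤ p (k + 1) ∧ ((k + 1 : ℕ) : ℝ) * h - h / 2 ≤ p k ∧
      p (k + 1) ≤ ((k + 1 : ℕ) : ℝ) * h + h / 2 ∧ h ≤ ((k + 1 : ℕ) : ℝ) * h := by
    intro k hk
    have hkk : (0:ℝ) ≤ k * h := by positivity
    have e1 : p k = (k + 1/2) * h := by simp only [hp, cellPt]; rw [if_neg (by omega)]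
    rw [e1]
    by_cases hkN : k + 1 = N
    · have e2 : p (k + 1) = ((k + 1 : ℕ) : ℝ) * h := by rw [hkN, hpN]
      rw [e2]; push_cast
      refine ⟨?_, ?_, ?_, ?_, ?_⟩ <;> nlinarith
    · have e2 : p (k + 1) = (((k + 1 : ℕ) : ℝ) + 1/2) * h := by
        simp only [hp, cellPt]; rw [if_neg hkN]
      rw [e2]; push_cast
      refine ⟨?_, ?_, ?_, ?_, ?_⟩ <;> nlinarith
  have hint : ∀ k < N, IntervalIntegrable F volume (p k) (p (k + 1)) := by
    intro k hk
    obtain ⟨c1, c2, -⟩ := hcell k hk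
    exact cont_aux α D hDc _ _ (by linarith) c2
  have hsum := intervalIntegral.sum_integral_adjacent_intervals hint
  have hint2 : IntervalIntegrable F volume (p 0) (p N) :=
    IntervalIntegrable.trans_iterate hint
  rw [hp0, hpN] at hsum hint2
  obtain ⟨z1, z2⟩ := zero_aux α ε M (h / 2) D hε hM (by positivity) hDc hD0
  rw [← intervalIntegral.integral_add_adjacent_intervals z1 hint2, ← hsum]
  have hS : |∑ k ∈ Finset.range N, (ω (k + 1) * (D ((k + 1 : ℕ) * h) / ((k + 1 : ℕ) * h) ^ 2) -
      ∫ t in p k..p (k + 1), F t)| ≤ 12 * M / α * h ^ ε := by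
    calc _ ≤ ∑ k ∈ Finset.range N, |ω (k + 1) * (D ((k + 1 : ℕ) * h) / ((k + 1 : ℕ) * h) ^ 2) -
          ∫ t in p k..p (k + 1), F t| := Finset.abs_sum_le_sum_abs _ _
      _ ≤ ∑ k ∈ Finset.range N, 6 * M * h ^ (α + ε) / α * (p k ^ (-α) - p (k + 1) ^ (-α)) := by
          apply Finset.sum_le_sum
          intro k hk
          have hk := Finset.mem_range.1 hk
          obtain ⟨c1, c2, c3, c4, c5⟩ := hcell k hk
          rw [hω k hk]
          refine (cell_aux α (α + ε) M h (p k) (p (k + 1)) _ D hα hα1 (by linarith)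
            (by linarith) hM hh c1 c2 c5 c3 c4 hDc hD0 hD).trans (le_of_eq ?_)
          ring
      _ = 6 * M * h ^ (α + ε) / α * ((h / 2) ^ (-α) - (N * h) ^ (-α)) := by
          rw [← Finset.mul_sum, Finset.sum_range_sub' (fun k => p k ^ (-α)), hp0, hpN]
      _ ≤ 6 * M * h ^ (α + ε) / α * (2 * h ^ (-α)) := by
          gcongr
          have : 0 ≤ ((N:ℝ) * h) ^ (-α) := by positivity
          have h2 : (h / 2) ^ (-α) ≤ 2 * h ^ (-α) := by
            rw [Real.div_rpow hh.le (by norm_num), Real.rpow_neg (by norm_num : (0:ℝ) ≤ 2),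
              div_inv_eq_mul, mul_comm]
            gcongr
            calc (2:ℝ) ^ α ≤ 2 ^ (1:ℝ) :=
                  Real.rpow_le_rpow_of_exponent_le (by norm_num) hα1.le
              _ = 2 := by norm_num
          linarith
      _ = 12 * M / α * (h ^ (α + ε) * h ^ (-α)) := by ring
      _ = _ := by rw [← Real.rpow_add hh]; congr 2; ring
  have hz : |∫ t in (0:ℝ)..(h / 2), F t| ≤ 2 * M / ε * h ^ ε := by
    refine z2.trans ?_
    have : (h / 2) ^ ε ≤ h ^ ε := by gcongr; linarith
    calc _ ≤ 2 * M * (h ^ ε / ε) := by gcongr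
      _ = _ := by ring
  have hw : |ω 0 * (D h / h ^ 2)| ≤ 2 * M * h ^ ε := by
    rw [hω0, abs_mul, abs_div (D h), abs_of_pos (by positivity : 0 < h ^ 2), abs_of_nonneg
      (div_nonneg (by positivity) (by linarith))]
    have h1 : (h / 2) ^ (2 - α) / (2 - α) ≤ h ^ (2 - α) := by
      calc _ ≤ (h / 2) ^ (2 - α) := div_le_self (by positivity) (by linarith)
        _ ≤ _ := Real.rpow_le_rpow (by positivity) (by linarith) (by linarith)
    calc _ ≤ h ^ (2 - α) * (2 * M * h ^ (α + ε) / h ^ 2) := by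
          gcongr
          exact hD0 h hh
      _ = _ := by
        have e : h ^ ε = h ^ (2 - α) * h ^ (α + ε) / h ^ 2 := by
          rw [← Real.rpow_add hh, ← Real.rpow_sub_natCast hh.ne']
          congr 1; push_cast; ring
        rw [e]; ring
  rw [Finset.sum_sub_distrib] at hS
  rw [abs_le] at *
  constructor <;> nlinarith [hS.1, hS.2, hz.1, hz.2, hw.1, hw.2]

/-- Consistency of the constant-basis operator-factorization quadrature with splitting
parameter `γ = 2` for the fractional Laplacian, for `u` bounded and `(α+ε)`-Hölder with
`α ∈ (0,1)` and `ε ∈ (0, 1−α)`: the quadrature error is `O(h^ε)` uniformly over the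
interior grid points. -/
theorem stmt14 (α ε a b M : ℝ) (hα : α ∈ Set.Ioo (0:ℝ) 1) (hε : ε ∈ Set.Ioo 0 (1 - α))
    (hab : a < b) (hM : 0 ≤ M) (u : ℝ → ℝ) (hbd : ∃ B : ℝ, ∀ x, |u x| ≤ B)
    (hHolder : ∀ s t : ℝ, |u s - u t| ≤ M * |s - t| ^ (α + ε)) :
    ∃ C : ℝ, 0 < C ∧ ∀ N : ℕ, 2 ≤ N →
      let L := b - a
      let h := L / N
      let σ₀ := 2 - α
      let ξ : ℕ → ℝ := fun k => k * h
      let ω : ℕ → ℝ := fun k =>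
        if k = 0 then (h / 2) ^ σ₀ / σ₀
        else if k = N then ((ξ N) ^ σ₀ - (((N : ℝ) - 1/2) * h) ^ σ₀) / σ₀
        else ((((k : ℝ) + 1/2) * h) ^ σ₀ - (((k : ℝ) - 1/2) * h) ^ σ₀) / σ₀
      let Φ : ℝ → ℝ → ℝ := fun x t => (u (x + t) - 2 * u x + u (x - t)) / t ^ 2
      ∀ i : ℕ, 1 ≤ i → i ≤ N - 1 →
        |((∑ k ∈ Finset.Icc 1 N, ω k * Φ (a + i * h) (ξ k)) + ω 0 * Φ (a + i * h) (ξ 1)) -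
            ∫ t in Set.Ioc (0:ℝ) L, Φ (a + i * h) t * t ^ (1 - α)| ≤ C * h ^ ε := by
  obtain ⟨hα0, hα1⟩ := hα
  obtain ⟨hε0, hε1⟩ := hε
  have hcu : Continuous u := by
    have : HolderWith (Real.toNNReal M) (Real.toNNReal (α + ε)) u := by
      intro s t
      rw [edist_dist, edist_dist, ENNReal.ofReal_rpow_of_nonneg dist_nonneg (by positivity)]
      rw [Real.coe_toNNReal _ (by linarith), ← ENNReal.ofReal, ← ENNReal.ofReal_mul hM]
      exact ENNReal.ofReal_le_ofReal (hHolder s t)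
    exact this.continuous (by simpa using by linarith)
  have hnn : 0 ≤ 2 * M + 2 * M / ε + 12 * M / α := by positivity
  refine ⟨2 * M + 2 * M / ε + 12 * M / α + 1, by linarith, ?_⟩
  intro N hN L h σ₀ ξ ω Φ i _ _
  have hL : 0 < L := sub_pos.2 hab
  have hNp : (0:ℝ) < N := by positivity
  have hh : 0 < h := div_pos hL hNp
  have hNh : (N:ℝ) * h = L := by simp only [h]; field_simp
  set x := a + i * h with hx
  set D : ℝ → ℝ := fun t => u (x + t) - 2 * u x + u (x - t) with hDdef
  have hDc : Continuous D := by fun_prop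
  have hD : ∀ s t, |D s - D t| ≤ 2 * M * |s - t| ^ (α + ε) := by
    intro s t
    have h1 := hHolder (x + s) (x + t)
    have h2 := hHolder (x - s) (x - t)
    rw [show x + s - (x + t) = s - t by ring] at h1
    rw [show x - s - (x - t) = t - s by ring, abs_sub_comm t s] at h2
    simp only [hDdef]
    rw [abs_le] at *
    constructor <;> linarith [h1.1, h1.2, h2.1, h2.2]
  have hD0 : ∀ t, 0 < t → |D t| ≤ 2 * M * t ^ (α + ε) := by
    intro t ht
    have := hD t 0
    have e : D 0 = 0 := by simp only [hDdef, add_zero, sub_zero]; ring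
    rwa [e, sub_zero, sub_zero, abs_of_pos ht] at this
  have key := main_aux α ε M h N D hα0 hα1 hε0 hε1 hM hh hN hDc hD0 hD ω (by simp [ω, σ₀]) (by
    intro k hk
    have e1 : cellPt N h k = (k + 1/2) * h := by simp only [cellPt]; rw [if_neg (by omega)]
    rw [e1]
    simp only [ω, ξ, σ₀, cellPt]
    rw [if_neg (by omega)]
    by_cases hkN : k + 1 = N
    · rw [if_pos hkN, if_pos hkN]
      have : (N:ℝ) - 1/2 = k + 1/2 := by rw [← hkN]; push_cast; ring
      rw [this]
    · rw [if_neg hkN, if_neg hkN]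
      have : ((k + 1 : ℕ):ℝ) - 1/2 = k + 1/2 := by push_cast; ring
      rw [this])
  have hs : ∑ k ∈ Finset.Icc 1 N, ω k * Φ x (ξ k) = ∑ k ∈ Finset.range N,
      ω (k + 1) * (D ((k + 1 : ℕ) * h) / ((k + 1 : ℕ) * h) ^ 2) := by
    rw [Finset.range_eq_Ico, Finset.sum_Ico_add' (fun k : ℕ => ω k * (D (k * h) / (k * h) ^ 2))]
    rfl
  have hξ : ξ 1 = h := by simp [ξ]
  rw [hs, hξ, ← intervalIntegral.integral_of_le hL.le]
  rw [hNh] at key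
  refine key.trans ?_
  have : 0 ≤ h ^ ε := by positivity
  nlinarith
end

section
/- Let α ∈ (0,1), ε ∈ (0, 1−α], a < b, L = b − a. For an integer N ≥ 2 set h = L/N, x_i = a + i·h, ξ_k = k·h, σ₀ = 2 − α, and define the constant-basis weights ω₀ = (h/2)^{σ₀}/σ₀, ω_k = (ξ_{k+1/2}^{σ₀} − ξ_{k−1/2}^{σ₀})/σ₀ for 1 ≤ k ≤ N−1, and ω_N = (ξ_N^{σ₀} − ξ_{N−1/2}^{σ₀})/σ₀, where ξ_{k±1/2} = (k ± 1/2)h. For u : ℝ → ℝ let Φ(x,ξ) = δ²u(x,ξ)/ξ² and define the quadrature Q_i = Σ_{k=1}^N ω_k Φ(x_i, ξ_k) + ω₀ Φ(x_i, ξ₁). Suppose u is bounded and twice continuously differentiable on ℝ with u'' bounded and satisfying |u''(s) − u''(t)| ≤ M|s − t|^{α+ε} for all s, t ∈ ℝ and some M ≥ 0. Then there exists a constant C > 0, independent of N, such that for every N ≥ 2, max_{1 ≤ i ≤ N−1} | Q_i − ∫_0^L Φ(x_i, ξ) ξ^{1−α} dξ | ≤ C h². -/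
open MeasureTheory Set

/-- first-order bound -/
lemma aux_first (f f1 : ℝ → ℝ) (p q c D : ℝ) (hc : c ∈ Icc p q)
    (h1 : ∀ t ∈ Icc p q, HasDerivAt f (f1 t) t) (hD : ∀ t ∈ Icc p q, |f1 t| ≤ D)
    (t : ℝ) (ht : t ∈ Icc p q) : |f t - f c| ≤ D * |t - c| := by
  have := (convex_Icc p q).norm_image_sub_le_of_norm_hasDerivWithin_le (f := f) (f' := f1) (C := D)
    (fun x hx => (h1 x hx).hasDerivWithinAt) (fun x hx => by simpa using hD x hx) hc ht
  simpa using this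

lemma aux_second (f f1 f2 : ℝ → ℝ) (p q c D : ℝ) (hc : c ∈ Icc p q)
    (h1 : ∀ t ∈ Icc p q, HasDerivAt f (f1 t) t) (h2 : ∀ t ∈ Icc p q, HasDerivAt f1 (f2 t) t)
    (hD : ∀ t ∈ Icc p q, |f2 t| ≤ D) (r : ℝ) (hr : ∀ t ∈ Icc p q, |t - c| ≤ r)
    (t : ℝ) (ht : t ∈ Icc p q) : |f t - f c - f1 c * (t - c)| ≤ D * r * r := by
  have hD0 : 0 ≤ D := (abs_nonneg _).trans (hD c hc)
  have hr0 : 0 ≤ r := (abs_nonneg _).trans (hr c hc)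
  have := aux_first (fun t => f t - f1 c * (t - c)) (fun t => f1 t - f1 c) p q c (D * r) hc
    (fun s hs => by
      have := (h1 s hs).sub (((hasDerivAt_id s).sub_const c).const_mul (f1 c))
      exact this.congr_deriv (by simp))
    (fun s hs => (aux_first f1 f2 p q c D hc h2 hD s hs).trans (by gcongr; exact hr s hs)) t ht
  simp only [sub_self, mul_zero, sub_zero] at this
  calc _ = |f t - f1 c * (t - c) - f c| := by congr 1; ring
    _ ≤ _ := this
    _ ≤ _ := by gcongr; exact hr t ht

/-- midpoint rule -/
lemma aux_mid (f f1 f2 : ℝ → ℝ) (c D r : ℝ) (hr : 0 ≤ r) (h0 : f c = 0)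
    (h1 : ∀ t ∈ Icc (c - r) (c + r), HasDerivAt f (f1 t) t)
    (h2 : ∀ t ∈ Icc (c - r) (c + r), HasDerivAt f1 (f2 t) t)
    (hD : ∀ t ∈ Icc (c - r) (c + r), |f2 t| ≤ D) :
    |∫ t in (c - r)..(c + r), f t| ≤ D * r * r * (2 * r) := by
  have hle : c - r ≤ c + r := by linarith
  have hi : IntervalIntegrable f volume (c - r) (c + r) := by
    apply ContinuousOn.intervalIntegrable
    rw [uIcc_of_le hle]
    exact fun t ht => (h1 t ht).continuousAt.continuousWithinAt
  have hi2 : IntervalIntegrable (fun t => f1 c * (t - c)) volume (c - r) (c + r) :=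
    (by fun_prop : Continuous fun t => f1 c * (t - c)).intervalIntegrable _ _
  have hz : ∫ t in (c - r)..(c + r), f1 c * (t - c) = 0 := by
    rw [intervalIntegral.integral_const_mul, intervalIntegral.integral_sub (by simp) (by simp)]
    simp; right; ring
  have e : ∫ t in (c - r)..(c + r), f t = ∫ t in (c - r)..(c + r), (f t - f1 c * (t - c)) := by
    rw [intervalIntegral.integral_sub hi hi2, hz, sub_zero]
  rw [e]
  have := intervalIntegral.norm_integral_le_of_norm_le_const (a := c - r) (b := c + r)
    (f := fun t => f t - f1 c * (t - c)) (C := D * r * r) (fun t ht => by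
      rw [uIoc_of_le hle] at ht
      have := aux_second f f1 f2 (c - r) (c + r) c D ⟨by linarith, by linarith⟩ h1 h2 hD r
        (fun t ht => abs_le.2 ⟨by linarith [ht.1], by linarith [ht.2]⟩) t ⟨ht.1.le, ht.2⟩
      simpa [h0] using this)
  have e2 : |c + r - (c - r)| = 2 * r := by rw [abs_of_nonneg (by linarith)]; ring
  rw [e2] at this
  simpa using this

lemma aux_sum (ε : ℝ) (h0 : 0 < ε) (h1 : ε ≤ 1) (n : ℕ) :
    ∑ k ∈ Finset.range n, ((k : ℝ) + 1) ^ (ε - 1) ≤ (n : ℝ) ^ ε / ε := by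
  induction n with
  | zero => simp [Real.zero_rpow h0.ne']
  | succ n ih =>
    rw [Finset.sum_range_succ]
    have hn : (0:ℝ) < n + 1 := by positivity
    have key : ((n:ℝ)) ^ ε ≤ (n + 1 : ℝ) ^ ε - ε * (n + 1 : ℝ) ^ (ε - 1) := by
      have hs : (-1 : ℝ) ≤ -1 / (n + 1) := by
        rw [le_div_iff₀ hn]; have : (0:ℝ) ≤ n := by positivity
        linarith
      have b := rpow_one_add_le_one_add_mul_self hs h0.le h1
      have e : (n : ℝ) = (1 + -1 / (n + 1)) * (n + 1) := by field_simp; ring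
      have hp : (0:ℝ) ≤ 1 + -1 / ((n:ℝ) + 1) := by linarith
      calc (n : ℝ) ^ ε = (1 + -1 / ((n:ℝ) + 1)) ^ ε * (n + 1 : ℝ) ^ ε := by
            rw [← Real.mul_rpow hp hn.le, ← e]
        _ ≤ (1 + ε * (-1 / (n + 1))) * (n + 1 : ℝ) ^ ε := by gcongr
        _ = _ := by rw [Real.rpow_sub_one hn.ne']; field_simp; ring
    push_cast
    have : (n + 1 : ℝ) ^ (ε - 1) = (ε * (n + 1 : ℝ) ^ (ε - 1)) / ε := by field_simp
    rw [this]
    calc _ ≤ (n:ℝ) ^ ε / ε + (ε * (n + 1 : ℝ) ^ (ε - 1)) / ε := by gcongr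
      _ = ((n:ℝ) ^ ε + (ε * (n + 1 : ℝ) ^ (ε - 1))) / ε := by ring
      _ ≤ _ := by gcongr; linarith

section
variable (α ε K A : ℝ) (P p1 p2 : ℝ → ℝ)

/-- the regularity package -/
structure Reg : Prop where
  α0 : 0 < α
  α1 : α < 1
  ε0 : 0 < ε
  ε1 : ε ≤ 1 - α
  d1 : ∀ t, 0 < t → HasDerivAt P (p1 t) t
  d2 : ∀ t, 0 < t → HasDerivAt p1 (p2 t) t
  b0 : ∀ t, 0 < t → |P t - A| ≤ K * t ^ (α + ε)
  b1 : ∀ t, 0 < t → |p1 t| ≤ K * t ^ (α + ε - 1)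
  b2 : ∀ t, 0 < t → |p2 t| ≤ K * t ^ (α + ε - 2)

variable {α ε K A P p1 p2}

lemma Reg.K0 (H : Reg α ε K A P p1 p2) : 0 ≤ K := by
  have := (abs_nonneg _).trans (H.b0 1 one_pos); simpa using this

/-- difference bound -/
lemma Reg.diff (H : Reg α ε K A P p1 p2) {c t : ℝ} (hc : 0 < c) (ht : 0 < t) (h : c ≤ 2 * t) :
    |P t - P c| ≤ 3 * K * t ^ (α + ε) := by
  have hK := H.K0
  have e1 := H.b0 t ht
  have e2 := H.b0 c hc
  have hα := H.α0; have hε := H.ε0; have hε' := H.ε1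
  have e3 : c ^ (α + ε) ≤ 2 * t ^ (α + ε) := by
    calc c ^ (α + ε) ≤ (2 * t) ^ (α + ε) := by gcongr
      _ = 2 ^ (α + ε) * t ^ (α + ε) := Real.mul_rpow (by norm_num) ht.le
      _ ≤ 2 ^ (1:ℝ) * t ^ (α + ε) := by gcongr <;> linarith
      _ = _ := by simp
  have e4 : K * c ^ (α + ε) ≤ K * (2 * t ^ (α + ε)) := by gcongr
  rw [abs_le] at *
  constructor <;> linarith

lemma Reg.fd1 (H : Reg α ε K A P p1 p2) (c : ℝ) {t : ℝ} (ht : 0 < t) :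
    HasDerivAt (fun t => (P t - P c) * t ^ (1 - α))
      (p1 t * t ^ (1 - α) + (P t - P c) * ((1 - α) * t ^ (-α))) t := by
  have := ((H.d1 t ht).sub_const (P c)).mul (Real.hasDerivAt_rpow_const (p := 1 - α) (Or.inl ht.ne'))
  rwa [show 1 - α - 1 = -α by ring] at this

lemma Reg.fd2 (H : Reg α ε K A P p1 p2) (c : ℝ) {t : ℝ} (ht : 0 < t) :
    HasDerivAt (fun t => p1 t * t ^ (1 - α) + (P t - P c) * ((1 - α) * t ^ (-α)))
      ((p2 t * t ^ (1 - α) + p1 t * ((1 - α) * t ^ (-α))) +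
       (p1 t * ((1 - α) * t ^ (-α)) + (P t - P c) * ((1 - α) * (-α * t ^ (-α - 1))))) t := by
  have A1 := (H.d2 t ht).mul (Real.hasDerivAt_rpow_const (p := 1 - α) (Or.inl ht.ne'))
  rw [show 1 - α - 1 = -α by ring] at A1
  have A2 := ((H.d1 t ht).sub_const (P c)).mul
    ((Real.hasDerivAt_rpow_const (p := -α) (Or.inl ht.ne')).const_mul (1 - α))
  exact A1.add A2

lemma Reg.fb1 (H : Reg α ε K A P p1 p2) {c t : ℝ} (hc : 0 < c) (ht : 0 < t) (h : c ≤ 2 * t) :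
    |p1 t * t ^ (1 - α) + (P t - P c) * ((1 - α) * t ^ (-α))| ≤ 4 * K * t ^ ε := by
  have hK := H.K0
  have hα := H.α0; have hα' := H.α1
  have e1 : |p1 t * t ^ (1 - α)| ≤ K * t ^ ε := by
    rw [abs_mul, abs_of_pos (Real.rpow_pos_of_pos ht _)]
    calc _ ≤ K * t ^ (α + ε - 1) * t ^ (1 - α) := by gcongr; exact H.b1 t ht
      _ = _ := by rw [mul_assoc, ← Real.rpow_add ht]; ring_nf
  have e2 : |(P t - P c) * ((1 - α) * t ^ (-α))| ≤ 3 * K * t ^ ε := by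
    rw [abs_mul, abs_mul, abs_of_pos (Real.rpow_pos_of_pos ht _), abs_of_pos (by linarith : 0 < 1 - α)]
    calc _ ≤ 3 * K * t ^ (α + ε) * (1 * t ^ (-α)) := by
          gcongr
          · exact H.diff hc ht h
          · linarith
      _ = _ := by rw [one_mul, mul_assoc, ← Real.rpow_add ht]; ring_nf
  calc _ ≤ _ := abs_add_le _ _
    _ ≤ _ := add_le_add e1 e2
    _ = _ := by ring

lemma Reg.fb2 (H : Reg α ε K A P p1 p2) {c t : ℝ} (hc : 0 < c) (ht : 0 < t) (h : c ≤ 2 * t) :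
    |(p2 t * t ^ (1 - α) + p1 t * ((1 - α) * t ^ (-α))) +
       (p1 t * ((1 - α) * t ^ (-α)) + (P t - P c) * ((1 - α) * (-α * t ^ (-α - 1))))|
      ≤ 12 * K * c ^ (ε - 1) := by
  have hK := H.K0
  have hα := H.α0; have hα' := H.α1
  have e1 : |p2 t * t ^ (1 - α)| ≤ K * t ^ (ε - 1) := by
    rw [abs_mul, abs_of_pos (Real.rpow_pos_of_pos ht _)]
    calc _ ≤ K * t ^ (α + ε - 2) * t ^ (1 - α) := by gcongr; exact H.b2 t ht
      _ = _ := by rw [mul_assoc, ← Real.rpow_add ht]; ring_nf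
  have e2 : |p1 t * ((1 - α) * t ^ (-α))| ≤ K * t ^ (ε - 1) := by
    rw [abs_mul, abs_mul, abs_of_pos (Real.rpow_pos_of_pos ht _), abs_of_pos (by linarith : 0 < 1 - α)]
    calc _ ≤ K * t ^ (α + ε - 1) * (1 * t ^ (-α)) := by
          gcongr
          · exact H.b1 t ht
          · linarith
      _ = _ := by rw [one_mul, mul_assoc, ← Real.rpow_add ht]; ring_nf
  have e3 : |(P t - P c) * ((1 - α) * (-α * t ^ (-α - 1)))| ≤ 3 * K * t ^ (ε - 1) := by
    rw [abs_mul, abs_mul, abs_mul, abs_neg, abs_of_pos hα, abs_of_pos (Real.rpow_pos_of_pos ht _),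
      abs_of_pos (by linarith : 0 < 1 - α)]
    calc _ ≤ 3 * K * t ^ (α + ε) * (1 * (1 * t ^ (-α - 1))) := by
          gcongr
          · exact H.diff hc ht h
          · linarith
      _ = _ := by rw [one_mul, one_mul, mul_assoc, ← Real.rpow_add ht]; ring_nf
  have e4 : t ^ (ε - 1) ≤ 2 * c ^ (ε - 1) := by
    have hε := H.ε0; have hε' := H.ε1
    calc t ^ (ε - 1) ≤ (c / 2) ^ (ε - 1) :=
          Real.rpow_le_rpow_of_nonpos (by positivity) (by linarith) (by linarith)
      _ = c ^ (ε - 1) * (1 / 2 : ℝ) ^ (ε - 1) := by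
          rw [← Real.mul_rpow hc.le (by norm_num)]; ring_nf
      _ ≤ c ^ (ε - 1) * (1 / 2 : ℝ) ^ (-1 : ℝ) := by
          gcongr ?_ * ?_
          apply Real.rpow_le_rpow_of_exponent_ge (by norm_num) (by norm_num) (by linarith)
      _ = _ := by rw [Real.rpow_neg_one]; ring
  calc _ ≤ _ := abs_add_le _ _
    _ ≤ (K * t ^ (ε - 1) + K * t ^ (ε - 1)) + (K * t ^ (ε - 1) + 3 * K * t ^ (ε - 1)) :=
        add_le_add ((abs_add_le _ _).trans (add_le_add e1 e2)) ((abs_add_le _ _).trans (add_le_add e2 e3))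
    _ = 6 * K * t ^ (ε - 1) := by ring
    _ ≤ 6 * K * (2 * c ^ (ε - 1)) := by gcongr
    _ = _ := by ring

lemma Reg.integrable (H : Reg α ε K A P p1 p2) (p q : ℝ) (hp : 0 ≤ p) (hq : p ≤ q) :
    IntervalIntegrable (fun t => P t * t ^ (1 - α)) volume p q := by
  have hα := H.α0; have hα' := H.α1; have hε := H.ε0
  have hK := H.K0
  rw [intervalIntegrable_iff_integrableOn_Ioc_of_le hq]
  have hq0 : 0 ≤ q := hp.trans hq
  refine IntegrableOn.of_bound (C := (|A| + K * q ^ (α + ε)) * q ^ (1 - α)) (by simp) ?_ ?_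
  · apply ContinuousOn.aestronglyMeasurable _ measurableSet_Ioc
    intro t ht
    have ht0 : 0 < t := hp.trans_lt ht.1
    exact ((H.d1 t ht0).continuousAt.mul
      (Real.continuousAt_rpow_const _ _ (Or.inl ht0.ne'))).continuousWithinAt
  · rw [ae_restrict_iff' measurableSet_Ioc]
    refine Filter.Eventually.of_forall fun t ht => ?_
    have ht0 : 0 < t := hp.trans_lt ht.1
    rw [Real.norm_eq_abs, abs_mul, abs_of_pos (Real.rpow_pos_of_pos ht0 _)]
    have e1 := H.b0 t ht0
    have e2 : K * t ^ (α + ε) ≤ K * q ^ (α + ε) := by gcongr; exact ht.2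
    have e3 : |P t| ≤ |A| + K * q ^ (α + ε) := by
      calc |P t| = |A + (P t - A)| := by congr 1; ring
        _ ≤ _ := abs_add_le _ _
        _ ≤ _ := by linarith
    have e4 : t ^ (1 - α) ≤ q ^ (1 - α) := by
      apply Real.rpow_le_rpow ht0.le ht.2 (by linarith)
    gcongr

/-- weight times value minus integral -/
lemma Reg.cell (H : Reg α ε K A P p1 p2) (p q c : ℝ) (hp : 0 ≤ p) (hq : p ≤ q) :
    (q ^ (2 - α) - p ^ (2 - α)) / (2 - α) * P c - ∫ t in p..q, P t * t ^ (1 - α)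
      = - ∫ t in p..q, (P t - P c) * t ^ (1 - α) := by
  have hα := H.α0; have hα' := H.α1
  have e : (q ^ (2 - α) - p ^ (2 - α)) / (2 - α) = ∫ t in p..q, t ^ (1 - α) := by
    rw [integral_rpow (Or.inl (by linarith))]; ring_nf
  have hi : IntervalIntegrable (fun t : ℝ => t ^ (1 - α)) volume p q :=
    intervalIntegral.intervalIntegrable_rpow' (by linarith)
  simp_rw [sub_mul]
  rw [intervalIntegral.integral_sub (H.integrable p q hp hq) (hi.const_mul _),
    intervalIntegral.integral_const_mul, e]
  ring

lemma Reg.core (H : Reg α ε K A P p1 p2) (L : ℝ) (hL : 0 < L) (n : ℕ) (h : ℝ)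
    (hh : h = L / (n + 1 : ℕ)) :
    |((∑ k ∈ Finset.range n, ((((k:ℝ) + 1 + 1/2) * h) ^ (2 - α) - (((k:ℝ) + 1 - 1/2) * h) ^ (2 - α))
        / (2 - α) * P (((k:ℝ) + 1) * h))
      + (L ^ (2 - α) - (((n : ℝ) + 1 - 1/2) * h) ^ (2 - α)) / (2 - α) * P L
      + (h / 2) ^ (2 - α) / (2 - α) * P h) - ∫ t in (0:ℝ)..L, P t * t ^ (1 - α)|
      ≤ (3 * K * L ^ ε / ε + K * L ^ ε + 3 * K * L ^ ε) * h ^ 2 := by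
  have hα := H.α0; have hα' := H.α1; have hε := H.ε0; have hε' := H.ε1
  have hK := H.K0
  have h0 : 0 < h := by rw [hh]; positivity
  have hLn : L = (n + 1) * h := by rw [hh]; push_cast; field_simp
  have hhL : h ≤ L := by rw [hLn]; nlinarith [(Nat.cast_nonneg n : (0:ℝ) ≤ n)]
  set F : ℝ → ℝ := fun t => P t * t ^ (1 - α) with hF
  have hint : ∀ p q, 0 ≤ p → p ≤ q → IntervalIntegrable F volume p q := H.integrable
  -- splitting
  have hsplit : ∫ t in (0:ℝ)..L, F t = (∫ t in (0:ℝ)..(h/2), F t) +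
      (∑ k ∈ Finset.range n, ∫ t in (((k:ℝ) + 1 - 1/2) * h)..(((k:ℝ) + 1 + 1/2) * h), F t)
      + ∫ t in (((n:ℝ) + 1 - 1/2) * h)..L, F t := by
    have hs := intervalIntegral.sum_integral_adjacent_intervals (f := F) (μ := volume)
      (a := fun k : ℕ => ((k:ℝ) + 1/2) * h) (n := n) (fun k _ => hint _ _ (by positivity) (by
        push_cast; nlinarith))
    have hs' : (∑ k ∈ Finset.range n, ∫ t in (((k:ℝ) + 1 - 1/2) * h)..(((k:ℝ) + 1 + 1/2) * h), F t)
        = ∫ t in (h/2)..(((n:ℝ) + 1 - 1/2) * h), F t := by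
      refine Eq.trans ?_ (hs.trans ?_)
      · refine Finset.sum_congr rfl fun k _ => ?_
        push_cast; ring_nf
      · push_cast; ring_nf
    have hn0 : (0:ℝ) ≤ n := by positivity
    have i1 := hint 0 (h/2) le_rfl (by positivity)
    have i2 := hint (h/2) (((n:ℝ) + 1 - 1/2) * h) (by positivity) (by nlinarith)
    have i3 := hint (((n:ℝ) + 1 - 1/2) * h) L (by nlinarith) (by rw [hLn]; nlinarith)
    rw [hs', intervalIntegral.integral_add_adjacent_intervals i1 i2,
      intervalIntegral.integral_add_adjacent_intervals (i1.trans i2) i3]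
  -- first cell
  have E0 : |(h / 2) ^ (2 - α) / (2 - α) * P h - ∫ t in (0:ℝ)..(h/2), F t| ≤ 3 * K * L ^ ε * h ^ 2 := by
    have hc := H.cell 0 (h/2) h le_rfl (by positivity)
    rw [Real.zero_rpow (by linarith), sub_zero] at hc
    rw [hF, hc, abs_neg]
    have := intervalIntegral.norm_integral_le_of_norm_le_const (a := 0) (b := h/2)
      (f := fun t => (P t - P h) * t ^ (1 - α)) (C := 2 * K * h ^ (α + ε) * h ^ (1 - α)) (fun t ht => by
        rw [uIoc_of_le (by positivity)] at ht
        have ht0 := ht.1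
        have hth : t ≤ h := by linarith [ht.2]
        rw [Real.norm_eq_abs, abs_mul, abs_of_pos (Real.rpow_pos_of_pos ht.1 _)]
        have a1 := H.b0 t ht.1
        have a2 := H.b0 h h0
        have a3 : K * t ^ (α + ε) ≤ K * h ^ (α + ε) := by gcongr
        have a4 : t ^ (1 - α) ≤ h ^ (1 - α) := by
          apply Real.rpow_le_rpow ht.1.le hth (by linarith)
        have a5 : |P t - P h| ≤ 2 * K * h ^ (α + ε) := by
          rw [abs_le] at *; constructor <;> linarith
        gcongr)
    rw [Real.norm_eq_abs, sub_zero, abs_of_pos (by positivity : 0 < h/2)] at this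
    refine this.trans ?_
    have e : h ^ (α + ε) * h ^ (1 - α) = h ^ ε * h := by
      rw [← Real.rpow_add h0, ← Real.rpow_add_one h0.ne']; ring_nf
    calc _ = 2 * K * (h ^ (α + ε) * h ^ (1 - α)) * (h / 2) := by ring
      _ = K * h ^ ε * h ^ 2 := by rw [e]; ring
      _ ≤ K * L ^ ε * h ^ 2 := by gcongr
      _ ≤ 3 * K * L ^ ε * h ^ 2 := by gcongr; linarith
  -- middle cells
  have Ek : ∀ k ∈ Finset.range n,
      |((((k:ℝ) + 1 + 1/2) * h) ^ (2 - α) - (((k:ℝ) + 1 - 1/2) * h) ^ (2 - α))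
        / (2 - α) * P (((k:ℝ) + 1) * h) -
        ∫ t in (((k:ℝ) + 1 - 1/2) * h)..(((k:ℝ) + 1 + 1/2) * h), F t|
      ≤ 3 * K * h ^ (2 + ε) * ((k:ℝ) + 1) ^ (ε - 1) := by
    intro k _
    have hk0 : (0:ℝ) ≤ k := by positivity
    have hkh : 0 ≤ k * h := by positivity
    rw [hF, H.cell _ _ _ (by nlinarith) (by nlinarith), abs_neg]
    set c := ((k:ℝ) + 1) * h with hc
    have hc0 : 0 < c := by positivity
    have hcc : c = k * h + h := by rw [hc]; ring
    rw [show ((k:ℝ) + 1 - 1/2) * h = c - h/2 by rw [hc]; ring,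
      show ((k:ℝ) + 1 + 1/2) * h = c + h/2 by rw [hc]; ring]
    have := aux_mid (fun t => (P t - P c) * t ^ (1 - α)) _ _ c (12 * K * c ^ (ε - 1)) (h/2)
      (by positivity) (by simp) (fun t ht => H.fd1 c (by linarith [ht.1]))
      (fun t ht => H.fd2 c (by linarith [ht.1]))
      (fun t ht => H.fb2 hc0 (by linarith [ht.1]) (by linarith [ht.1]))
    refine this.trans (le_of_eq ?_)
    rw [hc, Real.mul_rpow (by positivity) h0.le]
    have : h ^ (2 + ε) = h ^ (ε - 1) * h ^ 3 := by
      rw [← Real.rpow_natCast h 3, ← Real.rpow_add h0]; congr 1; push_cast; ring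
    rw [this]; ring
  -- last cell
  have EN : |(L ^ (2 - α) - (((n : ℝ) + 1 - 1/2) * h) ^ (2 - α)) / (2 - α) * P L -
      ∫ t in (((n:ℝ) + 1 - 1/2) * h)..L, F t| ≤ K * L ^ ε * h ^ 2 := by
    have hn0 : (0:ℝ) ≤ n := by positivity
    rw [show ((n:ℝ) + 1 - 1/2) * h = L - h/2 by rw [hLn]; ring]
    rw [hF, H.cell _ _ _ (by linarith) (by linarith), abs_neg]
    have := intervalIntegral.norm_integral_le_of_norm_le_const (a := L - h/2) (b := L)
      (f := fun t => (P t - P L) * t ^ (1 - α)) (C := 4 * K * L ^ ε * (h/2)) (fun t ht => by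
        rw [uIoc_of_le (by linarith)] at ht
        have := aux_first (fun t => (P t - P L) * t ^ (1 - α)) _ (L - h/2) L L (4 * K * L ^ ε)
          ⟨by linarith, le_rfl⟩ (fun t ht => H.fd1 L (by linarith [ht.1]))
          (fun t ht => (H.fb1 hL (by linarith [ht.1]) (by linarith [ht.1])).trans (by
            have := ht.2
            have : 0 < t := by linarith [ht.1]
            gcongr)) t ⟨ht.1.le, ht.2⟩
        simp only [sub_self, zero_mul, sub_zero] at this
        refine this.trans ?_
        gcongr
        exact abs_le.2 ⟨by linarith [ht.1], by linarith [ht.2]⟩)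
    rw [Real.norm_eq_abs, show L - (L - h/2) = h/2 by ring, abs_of_pos (by positivity : 0 < h/2)] at this
    refine this.trans (le_of_eq (by ring))
  rw [hsplit]
  have hsum := (Finset.abs_sum_le_sum_abs _ _).trans (Finset.sum_le_sum Ek)
  rw [← Finset.mul_sum, Finset.sum_sub_distrib] at hsum
  have hS : 3 * K * h ^ (2 + ε) * ∑ k ∈ Finset.range n, ((k:ℝ) + 1) ^ (ε - 1)
      ≤ 3 * K * L ^ ε / ε * h ^ 2 := by
    calc _ ≤ 3 * K * h ^ (2 + ε) * ((n:ℝ) ^ ε / ε) := by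
          gcongr; exact aux_sum ε hε (by linarith) n
      _ ≤ 3 * K * h ^ (2 + ε) * ((n + 1:ℝ) ^ ε / ε) := by gcongr; linarith
      _ = _ := by
          rw [hLn, Real.mul_rpow (by positivity) h0.le, Real.rpow_add h0, Real.rpow_two]; ring
  have hsum' := hsum.trans hS
  rw [abs_le] at *
  constructor <;> linarith [E0.1, E0.2, EN.1, EN.2, hsum'.1, hsum'.2]
end

lemma reg_of (α ε M : ℝ) (hα : α ∈ Set.Ioo (0:ℝ) 1) (hε : ε ∈ Set.Ioc 0 (1 - α))
    (hM : 0 ≤ M) (u : ℝ → ℝ) (hC2 : ContDiff ℝ 2 u)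
    (hHolder : ∀ s t : ℝ, |deriv (deriv u) s - deriv (deriv u) t| ≤ M * |s - t| ^ (α + ε)) (x : ℝ) :
    ∃ p1 p2, Reg α ε (22 * M) (deriv (deriv u) x)
      (fun t => (u (x + t) - 2 * u x + u (x - t)) / t ^ 2) p1 p2 := by
  have hβ : 0 < α + ε := by linarith [hα.1, hε.1]
  have du : ∀ y, HasDerivAt u (deriv u y) y := fun y =>
    (hC2.differentiable (by norm_num) y).hasDerivAt
  have ddu : ∀ y, HasDerivAt (deriv u) (deriv (deriv u) y) y := fun y =>
    (((contDiff_succ_iff_deriv (n := 1)).1 hC2).2.2.differentiable (by norm_num) y).hasDerivAt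
  set A := deriv (deriv u) x with hA
  set v := deriv u
  set w := deriv v
  have hadd : ∀ t, HasDerivAt (fun t => x + t) 1 t := fun t => (hasDerivAt_id t).const_add x
  have hsub : ∀ t, HasDerivAt (fun t => x - t) (-1) t := fun t => (hasDerivAt_id t).const_sub x
  let g : ℝ → ℝ := fun t => u (x + t) - 2 * u x + u (x - t) - A * t ^ 2
  let g1 : ℝ → ℝ := fun t => v (x + t) - v (x - t) - 2 * A * t
  let g2 : ℝ → ℝ := fun t => w (x + t) + w (x - t) - 2 * A
  have hg : ∀ t, HasDerivAt g (g1 t) t := fun t => by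
    have := ((((du (x + t)).comp t (hadd t)).sub_const (2 * u x)).add
      ((du (x - t)).comp t (hsub t))).sub ((hasDerivAt_pow 2 t).const_mul A)
    exact this.congr_deriv (by simp only [g1]; push_cast; ring)
  have hg1 : ∀ t, HasDerivAt g1 (g2 t) t := fun t => by
    have := (((ddu (x + t)).comp t (hadd t)).sub
      ((ddu (x - t)).comp t (hsub t))).sub ((hasDerivAt_id t).const_mul (2 * A))
    exact this.congr_deriv (by simp only [g2]; ring)
  have bg2 : ∀ t, 0 ≤ t → |g2 t| ≤ 2 * M * t ^ (α + ε) := fun t ht => by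
    have a1 := hHolder (x + t) x
    have a2 := hHolder (x - t) x
    rw [show x + t - x = t by ring, abs_of_nonneg ht] at a1
    rw [show x - t - x = -t by ring, abs_neg, abs_of_nonneg ht] at a2
    simp only [g2]
    rw [abs_le] at *
    constructor <;> linarith [a1.1, a1.2, a2.1, a2.2]
  have bg1 : ∀ t, 0 ≤ t → |g1 t| ≤ 2 * M * t ^ (α + ε) * t := fun t ht => by
    have := aux_first g1 g2 0 t 0 (2 * M * t ^ (α + ε)) ⟨le_rfl, ht⟩ (fun s _ => hg1 s)
      (fun s hs => (bg2 s hs.1).trans (by have := hs.1; have := hs.2; gcongr)) t ⟨ht, le_rfl⟩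
    simpa [g1, abs_of_nonneg ht] using this
  have bg : ∀ t, 0 ≤ t → |g t| ≤ 2 * M * t ^ (α + ε) * t * t := fun t ht => by
    have := aux_first g g1 0 t 0 (2 * M * t ^ (α + ε) * t) ⟨le_rfl, ht⟩ (fun s _ => hg s)
      (fun s hs => (bg1 s hs.1).trans (by have := hs.1; have := hs.2; gcongr)) t ⟨ht, le_rfl⟩
    have g0 : g 0 = 0 := by simp only [g, add_zero, sub_zero]; ring
    simpa [g0, abs_of_nonneg ht] using this
  have hP : ∀ t, t ≠ 0 → (u (x + t) - 2 * u x + u (x - t)) / t ^ 2 = g t / t ^ 2 + A := by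
    intro t ht; simp only [g]; field_simp; ring
  refine ⟨fun t => g1 t / t ^ 2 - 2 * g t / t ^ 3,
    fun t => g2 t / t ^ 2 - 4 * g1 t / t ^ 3 + 6 * g t / t ^ 4,
    hα.1, hα.2, hε.1, hε.2, ?_, ?_, ?_, ?_, ?_⟩
  · intro t ht
    have := ((hg t).div (hasDerivAt_pow 2 t) (by positivity)).add_const A
    refine (this.congr_of_eventuallyEq ?_).congr_deriv ?_
    · filter_upwards [eventually_ne_nhds ht.ne'] with s hs using hP s hs
    · push_cast; field_simp
  · intro t ht
    have := ((hg1 t).div (hasDerivAt_pow 2 t) (by positivity)).sub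
      (((hg t).const_mul 2).div (hasDerivAt_pow 3 t) (by positivity))
    refine this.congr_deriv ?_
    push_cast; field_simp; ring
  · intro t ht
    rw [hP t ht.ne', add_sub_cancel_right, abs_div, abs_of_pos (by positivity : 0 < t ^ 2),
      div_le_iff₀ (by positivity)]
    refine (bg t ht.le).trans ?_
    have : 0 ≤ M * t ^ (α + ε) * t ^ 2 := by positivity
    nlinarith
  · intro t ht
    have b1 := bg1 t ht.le
    have b0 := bg t ht.le
    have e : g1 t / t ^ 2 - 2 * g t / t ^ 3 = (g1 t * t - 2 * g t) / t ^ 3 := by field_simp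
    rw [Real.rpow_sub_one ht.ne']
    rw [e, abs_div, abs_of_pos (by positivity : 0 < t ^ 3), div_le_iff₀ (by positivity)]
    have r : 22 * M * (t ^ (α + ε) / t) * t ^ 3 = 22 * (M * t ^ (α + ε) * t ^ 2) := by field_simp
    rw [r]
    have hX : 0 ≤ M * t ^ (α + ε) * t ^ 2 := by positivity
    have c1 : |g1 t * t| ≤ 2 * (M * t ^ (α + ε) * t ^ 2) := by
      rw [abs_mul, abs_of_pos ht]
      calc _ ≤ 2 * M * t ^ (α + ε) * t * t := by gcongr
        _ = _ := by ring
    have c0 : |g t| ≤ 2 * (M * t ^ (α + ε) * t ^ 2) := b0.trans (le_of_eq (by ring))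
    rw [abs_le] at *
    constructor <;> linarith [c1.1, c1.2, c0.1, c0.2]
  · intro t ht
    have b2 := bg2 t ht.le
    have b1 := bg1 t ht.le
    have b0 := bg t ht.le
    have e : g2 t / t ^ 2 - 4 * g1 t / t ^ 3 + 6 * g t / t ^ 4
      = (g2 t * t ^ 2 - 4 * (g1 t * t) + 6 * g t) / t ^ 4 := by field_simp
    rw [Real.rpow_sub ht, Real.rpow_two]
    rw [e, abs_div, abs_of_pos (by positivity : 0 < t ^ 4), div_le_iff₀ (by positivity)]
    have r : 22 * M * (t ^ (α + ε) / t ^ 2) * t ^ 4 = 22 * (M * t ^ (α + ε) * t ^ 2) := by field_simp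
    rw [r]
    have c2 : |g2 t * t ^ 2| ≤ 2 * (M * t ^ (α + ε) * t ^ 2) := by
      rw [abs_mul, abs_of_pos (by positivity : 0 < t ^ 2)]
      calc _ ≤ 2 * M * t ^ (α + ε) * t ^ 2 := by gcongr
        _ = _ := by ring
    have c1 : |g1 t * t| ≤ 2 * (M * t ^ (α + ε) * t ^ 2) := by
      rw [abs_mul, abs_of_pos ht]
      calc _ ≤ 2 * M * t ^ (α + ε) * t * t := by gcongr
        _ = _ := by ring
    have c0 : |g t| ≤ 2 * (M * t ^ (α + ε) * t ^ 2) := b0.trans (le_of_eq (by ring))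
    rw [abs_le] at *
    constructor <;> linarith [c1.1, c1.2, c0.1, c0.2, c2.1, c2.2]

/-- Optimal second-order accuracy of the constant-basis operator-factorization quadrature
with splitting parameter `γ = 2`, for `u` bounded and `C²` with `u''` bounded and
`(α+ε)`-Hölder, where `α ∈ (0,1)` and `ε ∈ (0, 1−α]`: the quadrature error is `O(h²)`
uniformly over the interior grid points. -/
theorem stmt15 (α ε a b M : ℝ) (hα : α ∈ Set.Ioo (0:ℝ) 1) (hε : ε ∈ Set.Ioc 0 (1 - α))
    (hab : a < b) (hM : 0 ≤ M) (u : ℝ → ℝ) (hbd : ∃ B : ℝ, ∀ x, |u x| ≤ B)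
    (hC2 : ContDiff ℝ 2 u) (hbd2 : ∃ B₂ : ℝ, ∀ x, |deriv (deriv u) x| ≤ B₂)
    (hHolder : ∀ s t : ℝ, |deriv (deriv u) s - deriv (deriv u) t| ≤ M * |s - t| ^ (α + ε)) :
    ∃ C : ℝ, 0 < C ∧ ∀ N : ℕ, 2 ≤ N →
      let L := b - a
      let h := L / N
      let σ₀ := 2 - α
      let ξ : ℕ → ℝ := fun k => k * h
      let ω : ℕ → ℝ := fun k =>
        if k = 0 then (h / 2) ^ σ₀ / σ₀
        else if k = N then ((ξ N) ^ σ₀ - (((N : ℝ) - 1/2) * h) ^ σ₀) / σ₀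
        else ((((k : ℝ) + 1/2) * h) ^ σ₀ - (((k : ℝ) - 1/2) * h) ^ σ₀) / σ₀
      let Φ : ℝ → ℝ → ℝ := fun x t => (u (x + t) - 2 * u x + u (x - t)) / t ^ 2
      ∀ i : ℕ, 1 ≤ i → i ≤ N - 1 →
        |((∑ k ∈ Finset.Icc 1 N, ω k * Φ (a + i * h) (ξ k)) + ω 0 * Φ (a + i * h) (ξ 1)) -
            ∫ t in Set.Ioc (0:ℝ) L, Φ (a + i * h) t * t ^ (1 - α)| ≤ C * h ^ 2 := by
  have hL : 0 < b - a := by linarith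
  have hLp : 0 < (b - a) ^ ε := by positivity
  have hε0 := hε.1
  refine ⟨(3 * (22 * M) * (b - a) ^ ε / ε + (22 * M) * (b - a) ^ ε + 3 * (22 * M) * (b - a) ^ ε) + 1,
    by positivity, ?_⟩
  intro N hN L h σ₀ ξ ω Φ i _ _
  obtain ⟨n, rfl⟩ : ∃ n, N = n + 1 := ⟨N - 1, by omega⟩
  obtain ⟨p1, p2, H⟩ := reg_of α ε M hα hε hM u hC2 hHolder (a + i * h)
  have key := H.core L hL n h rfl
  have hNL : ξ (n + 1) = L := by
    simp only [ξ, h]; field_simp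
  have hω0 : ω 0 = (h / 2) ^ (2 - α) / (2 - α) := by simp [ω, σ₀]
  have hωN : ω (n + 1) = (L ^ (2 - α) - (((n:ℝ) + 1 - 1/2) * h) ^ (2 - α)) / (2 - α) := by
    simp only [ω, hNL, σ₀]; simp
  have hωk : ∀ k ∈ Finset.range n, ω (k + 1) = ((((k:ℝ) + 1 + 1/2) * h) ^ (2 - α)
      - (((k:ℝ) + 1 - 1/2) * h) ^ (2 - α)) / (2 - α) := by
    intro k hk
    have : k ≠ n := by have := Finset.mem_range.1 hk; omega
    simp [ω, σ₀, this]
  have hs : ∑ k ∈ Finset.Icc 1 (n + 1), ω k * Φ (a + i * h) (ξ k)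
      = (∑ k ∈ Finset.range n, ((((k:ℝ) + 1 + 1/2) * h) ^ (2 - α)
      - (((k:ℝ) + 1 - 1/2) * h) ^ (2 - α)) / (2 - α) * Φ (a + i * h) (((k:ℝ) + 1) * h))
      + (L ^ (2 - α) - (((n:ℝ) + 1 - 1/2) * h) ^ (2 - α)) / (2 - α) * Φ (a + i * h) L := by
    have : Finset.Icc 1 (n + 1) = Finset.Ico 1 (n + 2) := by ext; simp; omega
    rw [this, Finset.sum_Ico_eq_sum_range, show n + 2 - 1 = n + 1 by omega, Finset.sum_range_succ]
    congr 1
    · refine Finset.sum_congr rfl fun k hk => ?_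
      rw [add_comm 1 k, hωk k hk]
      simp [ξ]
    · rw [add_comm 1 n, hωN, hNL]
  have hξ1 : ξ 1 = h := by simp [ξ]
  rw [hs, hω0, hξ1, ← intervalIntegral.integral_of_le hL.le]
  refine key.trans ?_
  apply mul_le_mul_of_nonneg_right _ (sq_nonneg h)
  simp only [L]
  linarith
end
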